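/- arXiv:2602.03758 — 2 statements merged into one kernel-verified Lean document; each statement's English description precedes it below -/
import Mathlib

section
/- Let R be an infinite commutative ring, A ⊆ R piecewise syndetic in (R,+), F a finite set of polynomials with zero constant term, and ⟨x_n⟩_{n=1}^∞ any sequence in R. Then the set {a ∈ R : there exists a nonempty finite K ⊆ ℕ such that a + f(∑_{t∈K} x_t) ∈ A for all f ∈ F} is piecewise syndetic in (R,+). -/
/-- `A` is piecewise syndetic in the commutative semigroup `(S,+)`. -/
def PiecewiseSyndetic {S : Type*} [AddCommSemigroup S] (A : Set S) : Prop :=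
  ∃ G : Finset S, ∀ F : Finset S, ∃ x : S, ∀ f ∈ F, ∃ t ∈ G, t + (f + x) ∈ A

universe u

open Polynomial

/-- Every finite coloring of `R` has, within finite data that do not depend on the coloring,
a monochromatic configuration `{d} ∪ {d + f(∑_{t ∈ K} x_t) : f ∈ F}` with `K` nonempty. -/
def IPMonochromatic {R : Type u} [CommRing R] (F : Finset R[X]) : Prop :=
  ∀ (κ : Type u) [Finite κ] (x : ℕ → R), ∃ (D : Finset R) (N : ℕ), ∀ c : R → κ,
    ∃ d ∈ D, ∃ K ⊆ Finset.range N, K.Nonempty ∧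
      ∀ f ∈ F, c (d + f.eval (∑ t ∈ K, x t)) = c d

/-- The polynomial `f(X + h) - f(h) - g(X)`. -/
noncomputable def shiftSub {R : Type*} [CommRing R] (g : R[X]) (f : R[X]) (h : R) : R[X] :=
  taylor h f - C (f.eval h) - g

open Classical in
/-- All polynomials `f(X + h) - f(h) - g(X)` with `f ∈ F` and `h ∈ H`. -/
noncomputable def shiftSubFamily {R : Type*} [CommRing R] (g : R[X]) (F : Finset R[X])
    (H : Finset R) : Finset R[X] :=
  (F ×ˢ H).image fun p => shiftSub g p.1 p.2

lemma eval_shiftSub {R : Type*} [CommRing R] (g f : R[X]) (h y : R) :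
    (shiftSub g f h).eval y = f.eval (h + y) - f.eval h - g.eval y := by
  simp [shiftSub, taylor_eval, add_comm]

lemma coeff_shiftSub {R : Type*} [CommRing R] (g f : R[X]) (h : R) {n : ℕ} (hn : n ≠ 0) :
    (shiftSub g f h).coeff n = (taylor h f).coeff n - g.coeff n := by
  simp [shiftSub, coeff_C, hn]

open Classical in
/-- The color-focusing argument: if `F` is not already monochromatic somewhere, one finds
arbitrarily many colors focused at a single point. -/
lemma exists_focused {R : Type u} [CommRing R] (F : Finset R[X]) (g : R[X])
    (hF : ∀ f ∈ F, f.coeff 0 = 0)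
    (hP : ∀ H : Finset R, IPMonochromatic (shiftSubFamily g F H))
    (κ : Type u) [Finite κ] (x : ℕ → R) (s : ℕ) :
    ∃ (D : Finset R) (N : ℕ), ∀ c : R → κ,
      (∃ d ∈ D, ∃ K ⊆ Finset.range N, K.Nonempty ∧
        ∀ f ∈ F, c (d + f.eval (∑ t ∈ K, x t)) = c d) ∨
      ∃ a ∈ D, ∃ S : Finset κ, S.card = s ∧ c a ∉ S ∧
        ∀ k ∈ S, ∃ K ⊆ Finset.range N, K.Nonempty ∧
          ∀ f ∈ F, c (a + f.eval (∑ t ∈ K, x t)) = k := by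
  induction s with
  | zero => exact ⟨{0}, 0, fun c => Or.inr ⟨0, by simp, ∅, by simp⟩⟩
  | succ s ih =>
    obtain ⟨D, N, hDN⟩ := ih
    set H : Finset R := (Finset.range N).powerset.image fun K => ∑ t ∈ K, x t
    set E : Finset R := D ∪ (D ×ˢ F ×ˢ H).image fun p => p.1 + p.2.1.eval p.2.2
    obtain ⟨D', N', hDN'⟩ := hP H (E → κ) fun n => x (N + n)
    refine ⟨(D ×ˢ D').image (fun p => p.1 + p.2) ∪
      (D ×ˢ D' ×ˢ (Finset.range N').powerset).image
        (fun p => p.1 + p.2.1 - g.eval (∑ t ∈ p.2.2, x (N + t))), N + N', fun c => ?_⟩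
    obtain ⟨b, hb, L, hL, hLne, hbL⟩ := hDN' fun z e => c (z + e)
    have hrange : Finset.range N ⊆ Finset.range (N + N') :=
      Finset.range_subset_range.2 (Nat.le_add_right _ _)
    set y := ∑ t ∈ L, x (N + t) with hy
    set L' := L.map (addLeftEmbedding N) with hL'
    have hL'y : ∑ t ∈ L', x t = y := by simp [hL', hy]
    have hL'sub : L' ⊆ Finset.range (N + N') := by
      intro n hn
      obtain ⟨m, hm, rfl⟩ := Finset.mem_map.1 hn
      have := Finset.mem_range.1 (hL hm)
      simp only [addLeftEmbedding_apply, Finset.mem_range]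
      omega
    have hL'ne : L'.Nonempty := by simpa [hL'] using hLne
    have hcolor : ∀ f ∈ F, ∀ h ∈ H, ∀ e ∈ E,
        c (b + (f.eval (h + y) - f.eval h - g.eval y) + e) = c (b + e) := by
      intro f hf h hh e he
      have := congrFun (hbL (shiftSub g f h)
        (Finset.mem_image.2 ⟨(f, h), Finset.mem_product.2 ⟨hf, hh⟩, rfl⟩)) ⟨e, he⟩
      simpa only [eval_shiftSub] using this
    rcases hDN fun z => c (b + z) with ⟨d, hd, K, hK, hKne, hmono⟩ | ⟨a, ha, S, hS, haS, hfoc⟩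
    · refine Or.inl ⟨d + b, Finset.mem_union_left _ (Finset.mem_image.2
        ⟨(d, b), Finset.mem_product.2 ⟨hd, hb⟩, rfl⟩), K, hK.trans hrange, hKne, fun f hf => ?_⟩
      have := hmono f hf
      rwa [← add_assoc, add_comm b d] at this
    · set a' := a + b - g.eval y with ha'
      have ha'mem : a' ∈ (D ×ˢ D').image (fun p => p.1 + p.2) ∪
          (D ×ˢ D' ×ˢ (Finset.range N').powerset).image
          (fun p => p.1 + p.2.1 - g.eval (∑ t ∈ p.2.2, x (N + t))) :=
        Finset.mem_union_right _ (Finset.mem_image.2 ⟨(a, b, L), by simp [ha, hb, hL], rfl⟩)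
      have hfoc' : ∀ k ∈ insert (c (b + a)) S, ∃ K ⊆ Finset.range (N + N'), K.Nonempty ∧
          ∀ f ∈ F, c (a' + f.eval (∑ t ∈ K, x t)) = k := by
        intro k hk
        rcases Finset.mem_insert.1 hk with rfl | hk
        · refine ⟨L', hL'sub, hL'ne, fun f hf => ?_⟩
          have h0 : f.eval 0 = 0 := by rw [← coeff_zero_eq_eval_zero, hF f hf]
          have := hcolor f hf 0 (Finset.mem_image.2 ⟨∅, by simp, by simp⟩) a
            (Finset.mem_union_left _ ha)
          rw [hL'y, ← this, zero_add, h0]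
          congr 1
          ring
        · obtain ⟨K, hK, hKne, hmono⟩ := hfoc k hk
          refine ⟨K ∪ L', Finset.union_subset (hK.trans hrange) hL'sub,
            hKne.mono Finset.subset_union_left, fun f hf => ?_⟩
          have hdisj : Disjoint K L' := by
            rw [Finset.disjoint_left]
            intro n hn hn'
            obtain ⟨m, -, rfl⟩ := Finset.mem_map.1 hn'
            have := Finset.mem_range.1 (hK hn)
            simp only [addLeftEmbedding_apply] at this
            omega
          have hKH : ∑ t ∈ K, x t ∈ H :=
            Finset.mem_image.2 ⟨K, Finset.mem_powerset.2 hK, rfl⟩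
          have := hcolor f hf _ hKH (a + f.eval (∑ t ∈ K, x t))
            (Finset.mem_union_right _ (Finset.mem_image.2
              ⟨(a, f, ∑ t ∈ K, x t), by simp only [Finset.mem_product]; exact ⟨ha, hf, hKH⟩, rfl⟩))
          rw [Finset.sum_union hdisj, hL'y, ← hmono f hf, ← this]
          congr 1
          ring
      by_cases hc : c a' ∈ insert (c (b + a)) S
      · obtain ⟨K, hK, hKne, hmono⟩ := hfoc' _ hc
        exact Or.inl ⟨a', ha'mem, K, hK, hKne, hmono⟩
      · exact Or.inr ⟨a', ha'mem, insert (c (b + a)) S,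
          by rw [Finset.card_insert_of_notMem haS, hS], hc, hfoc'⟩

lemma IPMonochromatic.of_shiftSubFamily {R : Type*} [CommRing R] (F : Finset R[X]) (g : R[X])
    (hF : ∀ f ∈ F, f.coeff 0 = 0)
    (hP : ∀ H : Finset R, IPMonochromatic (shiftSubFamily g F H)) : IPMonochromatic F := by
  intro κ _ x
  have := Fintype.ofFinite κ
  obtain ⟨D, N, h⟩ := exists_focused F g hF hP κ x (Fintype.card κ)
  refine ⟨D, N, fun c => (h c).resolve_right ?_⟩
  rintro ⟨a, -, S, hS, haS, -⟩
  rw [(Finset.card_eq_iff_eq_univ S).1 hS] at haS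
  exact haS (Finset.mem_univ _)

open Classical in
/-- The pairs (degree, leading coefficient) of the nonzero members of `F`. -/
noncomputable def leadingData {R : Type*} [CommRing R] (F : Finset R[X]) : Finset (ℕ × R) :=
  (F.erase 0).image fun f => (f.natDegree, f.leadingCoeff)

/-- The multiset of degrees of the distinct leading terms of `F`. -/
noncomputable def leadingWeight {R : Type*} [CommRing R] (F : Finset R[X]) : Multiset ℕ :=
  (leadingData F).val.map Prod.fst

open Classical in
lemma leadingWeight_shiftSubFamily_lt {R : Type*} [CommRing R] (F : Finset R[X]) (h0 : 0 ∉ F)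
    (hF : ∀ f ∈ F, f.coeff 0 = 0) (g : R[X]) (hg : g ∈ F)
    (hmin : ∀ f ∈ F, g.natDegree ≤ f.natDegree) (H : Finset R) :
    Multiset.IsDershowitzMannaLT (leadingWeight (shiftSubFamily g F H)) (leadingWeight F) := by
  have hgdeg : g.natDegree ≠ 0 := by
    intro h
    have hg0 : g = 0 := by rw [eq_C_of_natDegree_eq_zero h, hF g hg, C_0]
    exact h0 (hg0 ▸ hg)
  set d := g.natDegree
  set F' := shiftSubFamily g F H
  set φ : ℕ × R → ℕ × R := fun p => if p.1 = d then (p.1, p.2 + g.leadingCoeff) else p with hφ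
  have hφfst : ∀ p, (φ p).1 = p.1 := by
    intro p
    simp only [hφ]
    split_ifs <;> rfl
  have hφinj : Function.Injective φ := by
    rintro ⟨m, u⟩ ⟨n, v⟩ h
    have h1 : m = n := by simpa only [hφfst] using congrArg Prod.fst h
    subst h1
    simp only [hφ] at h
    split_ifs at h <;> simpa using h
  set T := (leadingData F').filter fun p => d ≤ p.1 with hT
  have hsub : T.image φ ⊆ (leadingData F).erase (d, g.leadingCoeff) := by
    intro q hq
    obtain ⟨p, hp, rfl⟩ := Finset.mem_image.1 hq
    obtain ⟨hp, hdp⟩ := Finset.mem_filter.1 hp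
    obtain ⟨u, hu, rfl⟩ := Finset.mem_image.1 hp
    obtain ⟨hu0, hu⟩ := Finset.mem_erase.1 hu
    obtain ⟨⟨f, h⟩, hfh, rfl⟩ := Finset.mem_image.1 hu
    obtain ⟨hf, -⟩ := Finset.mem_product.1 hfh
    simp only at hf hdp hu0 ⊢
    have hf0 : f ≠ 0 := fun h => h0 (h ▸ hf)
    have hle : (shiftSub g f h).natDegree ≤ f.natDegree := by
      refine (natDegree_sub_le _ _).trans (max_le ((natDegree_sub_le _ _).trans ?_) (hmin f hf))
      simp
    have hfdeg : f.natDegree ≠ 0 := by have := hmin f hf; omega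
    have hcoef := coeff_shiftSub g f h hfdeg
    rw [coeff_taylor_natDegree] at hcoef
    have hmem : (f.natDegree, f.leadingCoeff) ∈ leadingData F :=
      Finset.mem_image.2 ⟨f, Finset.mem_erase.2 ⟨hf0, hf⟩, rfl⟩
    have hlc : (shiftSub g f h).leadingCoeff ≠ 0 := leadingCoeff_ne_zero.2 hu0
    rcases (hmin f hf).eq_or_lt with heq | hlt
    · have hdeg : (shiftSub g f h).natDegree = f.natDegree := by omega
      have hlc' : (shiftSub g f h).leadingCoeff = f.leadingCoeff - g.leadingCoeff := by
        rw [leadingCoeff, hdeg, hcoef, ← heq, coeff_natDegree]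
      have : φ ((shiftSub g f h).natDegree, (shiftSub g f h).leadingCoeff) =
          (f.natDegree, f.leadingCoeff) := by
        simp [hφ, hdeg, ← heq, hlc']
      rw [this]
      refine Finset.mem_erase.2 ⟨fun h => hlc ?_, hmem⟩
      rw [hlc', show f.leadingCoeff = g.leadingCoeff from (Prod.ext_iff.1 h).2, sub_self]
    · rw [coeff_eq_zero_of_natDegree_lt hlt, sub_zero] at hcoef
      have hdeg : (shiftSub g f h).natDegree = f.natDegree :=
        le_antisymm hle (le_natDegree_of_ne_zero (hcoef ▸ leadingCoeff_ne_zero.2 hf0))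
      have : φ ((shiftSub g f h).natDegree, (shiftSub g f h).leadingCoeff) =
          (f.natDegree, f.leadingCoeff) := by
        rw [leadingCoeff, hdeg, hcoef]
        simp [hφ, hlt.ne']
      rw [this]
      exact Finset.mem_erase.2 ⟨fun h => hlt.ne' (Prod.ext_iff.1 h).1, hmem⟩
  have hgdata : (d, g.leadingCoeff) ∈ leadingData F :=
    Finset.mem_image.2 ⟨g, Finset.mem_erase.2 ⟨fun h => h0 (h ▸ hg), hg⟩, rfl⟩
  have hsub' : T.image φ ⊆ leadingData F := hsub.trans (Finset.erase_subset _ _)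
  have hgZ : (d, g.leadingCoeff) ∈ leadingData F \ T.image φ :=
    Finset.mem_sdiff.2 ⟨hgdata, fun h => (Finset.mem_erase.1 (hsub h)).1 rfl⟩
  have hdZ : d ∈ (leadingData F \ T.image φ).val.map Prod.fst :=
    Multiset.mem_map.2 ⟨_, hgZ, rfl⟩
  refine ⟨T.val.map Prod.fst, ((leadingData F').filter fun p => ¬ d ≤ p.1).val.map Prod.fst,
    (leadingData F \ T.image φ).val.map Prod.fst, ?_, ?_, ?_, ?_⟩
  · intro h
    rw [h] at hdZ
    exact Multiset.notMem_zero d hdZ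
  · rw [leadingWeight, ← Multiset.map_add, hT, Finset.filter_val, Finset.filter_val,
      Multiset.filter_add_not]
  · have hTφ : T.val.map Prod.fst = (T.image φ).val.map Prod.fst := by
      rw [Finset.image_val_of_injOn hφinj.injOn, Multiset.map_map]
      exact Multiset.map_congr rfl fun p _ => (hφfst p).symm
    rw [hTφ, ← Multiset.map_add, leadingWeight, Finset.sdiff_val,
      add_tsub_cancel_of_le (Finset.val_le_iff.2 hsub')]
  · intro n hn
    obtain ⟨p, hp, rfl⟩ := Multiset.mem_map.1 hn
    exact ⟨d, hdZ, not_le.1 (Finset.mem_filter.1 hp).2⟩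

open Classical in
lemma leadingWeight_erase_zero {R : Type*} [CommRing R] (F : Finset R[X]) :
    leadingWeight (F.erase 0) = leadingWeight F := by
  simp [leadingWeight, leadingData]

open Classical in
lemma IPMonochromatic.of_erase_zero {R : Type*} [CommRing R] {F : Finset R[X]}
    (h : IPMonochromatic (F.erase 0)) : IPMonochromatic F := by
  intro κ _ x
  obtain ⟨D, N, hDN⟩ := h κ x
  refine ⟨D, N, fun c => ?_⟩
  obtain ⟨d, hd, K, hK, hKne, hmono⟩ := hDN c
  refine ⟨d, hd, K, hK, hKne, fun f hf => ?_⟩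
  by_cases hf0 : f = 0
  · simp [hf0]
  · exact hmono f (Finset.mem_erase.2 ⟨hf0, hf⟩)

open Classical in
/-- The finitary IP polynomial van der Waerden theorem over a commutative ring. -/
theorem ipMonochromatic {R : Type*} [CommRing R] (F : Finset R[X])
    (hF : ∀ f ∈ F, f.coeff 0 = 0) : IPMonochromatic F := by
  induction hw : leadingWeight F using
    (Multiset.wellFounded_isDershowitzMannaLT (α := ℕ)).induction generalizing F with
  | _ w ih =>
  subst hw
  apply IPMonochromatic.of_erase_zero
  have hF0 : ∀ f ∈ F.erase 0, f.coeff 0 = 0 := fun f hf => hF f (Finset.mem_of_mem_erase hf)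
  rcases (F.erase 0).eq_empty_or_nonempty with he | hne
  · rw [he]
    exact fun κ _ x => ⟨{0}, 1, fun c => ⟨0, by simp, {0}, by simp⟩⟩
  · obtain ⟨g, hg, hmin⟩ := (F.erase 0).exists_min_image natDegree hne
    refine IPMonochromatic.of_shiftSubFamily _ g hF0 fun H => ih _ ?_ _ ?_ rfl
    · rw [← leadingWeight_erase_zero F]
      exact leadingWeight_shiftSubFamily_lt _ (Finset.notMem_erase _ _) hF0 g hg hmin H
    · intro u hu
      obtain ⟨⟨f, h⟩, -, rfl⟩ := Finset.mem_image.1 hu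
      rw [coeff_zero_eq_eval_zero, eval_shiftSub, ← coeff_zero_eq_eval_zero g, hF0 g hg]
      simp

/-- If `A` is piecewise syndetic in an infinite commutative ring, `F` a finite set of
polynomials with zero constant term, and `⟨x_n⟩` any sequence, then
`{a : ∃ finite nonempty K, ∀ f ∈ F, a + f(∑_{t∈K} x_t) ∈ A}` is piecewise syndetic. -/
theorem stmt_12 {R : Type*} [CommRing R] [Infinite R] (A : Set R)
    (hA : PiecewiseSyndetic A) (F : Finset (Polynomial R)) (hF : ∀ f ∈ F, f.coeff 0 = 0)
    (x : ℕ → R) :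
    PiecewiseSyndetic {a : R | ∃ K : Finset ℕ, K.Nonempty ∧
      ∀ f ∈ F, a + f.eval (∑ t ∈ K, x t) ∈ A} := by
  classical
  obtain ⟨G, hG⟩ := hA
  obtain ⟨D, N, hDN⟩ := ipMonochromatic F hF (insert 0 G : Finset R) x
  refine ⟨(G ×ˢ D).image fun p => p.1 + p.2, fun H => ?_⟩
  set E : Finset R := D ∪ (D ×ˢ F ×ˢ (Finset.range N).powerset).image
    (fun p => p.1 + p.2.1.eval (∑ t ∈ p.2.2, x t))
  obtain ⟨y, hy⟩ := hG ((H ×ˢ E).image fun p => p.1 + p.2)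
  refine ⟨y, fun h hh => ?_⟩
  have hy' : ∀ e ∈ E, ∃ t ∈ G, t + (h + e + y) ∈ A := fun e he =>
    hy _ (Finset.mem_image.2 ⟨(h, e), Finset.mem_product.2 ⟨hh, he⟩, rfl⟩)
  have hcol : ∀ e : R, ∃ t : (insert 0 G : Finset R), e ∈ E → t.1 ∈ G ∧ t.1 + (h + e + y) ∈ A := by
    intro e
    by_cases he : e ∈ E
    · obtain ⟨t, ht, htA⟩ := hy' e he
      exact ⟨⟨t, Finset.mem_insert_of_mem ht⟩, fun _ => ⟨ht, htA⟩⟩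
    · exact ⟨⟨0, Finset.mem_insert_self _ _⟩, fun h => absurd h he⟩
  choose c hc using hcol
  obtain ⟨d, hd, K, hK, hKne, hmono⟩ := hDN c
  refine ⟨(c d).1 + d, Finset.mem_image.2 ⟨((c d).1, d), Finset.mem_product.2
    ⟨(hc d (Finset.mem_union_left _ hd)).1, hd⟩, rfl⟩, K, hKne, fun f hf => ?_⟩
  have := (hc (d + f.eval (∑ t ∈ K, x t)) (Finset.mem_union_right _ (Finset.mem_image.2
    ⟨(d, f, K), by simp [hd, hf, hK], rfl⟩))).2
  rw [hmono f hf] at this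
  convert this using 1
  ring
end

section
/- Let R be a large ideal domain, r ∈ ℕ, F a finite set of polynomials over R with zero constant term, and R = C₁ ∪ ... ∪ C_r a finite coloring. Then there exist i ∈ {1,...,r}, an injective sequence ⟨z_n⟩ in R∖{0,1}, and a sequence ⟨E_n⟩ of piecewise syndetic subsets of (R,+) such that for each n, E_n ⊆ Rz_n, and whenever w ∈ E_n and x ∈ R satisfies x·z_n = w, the set {x·z_n} ∪ {x + f(z_n) : f ∈ F} is contained in C_i. -/
namespace PiecewiseSyndetic

theorem mono {S : Type*} [AddCommSemigroup S] {A B : Set S} (h : PiecewiseSyndetic A)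
    (hAB : A ⊆ B) : PiecewiseSyndetic B := by
  obtain ⟨G, hG⟩ := h
  refine ⟨G, fun F => ?_⟩
  obtain ⟨x, hx⟩ := hG F
  refine ⟨x, fun f hf => ?_⟩
  obtain ⟨t, ht, h⟩ := hx f hf
  exact ⟨t, ht, hAB h⟩

theorem univ {M : Type*} [AddCommGroup M] : PiecewiseSyndetic (Set.univ : Set M) :=
  ⟨{0}, fun _ => ⟨0, fun _ _ => ⟨0, by simp⟩⟩⟩

theorem nonempty {M : Type*} [AddCommGroup M] {A : Set M} (h : PiecewiseSyndetic A) :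
    A.Nonempty := by
  obtain ⟨G, hG⟩ := h
  obtain ⟨x, hx⟩ := hG {0}
  obtain ⟨t, -, h⟩ := hx 0 (by simp)
  exact ⟨_, h⟩

/-- Piecewise syndeticity is partition regular. -/
theorem of_union {M : Type*} [AddCommGroup M] {A B : Set M}
    (h : PiecewiseSyndetic (A ∪ B)) : PiecewiseSyndetic A ∨ PiecewiseSyndetic B := by
  classical
  obtain ⟨G, hG⟩ := h
  by_cases hB : ∀ F : Finset M, ∃ x : M, ∀ f ∈ F, ∃ t ∈ G, t + (f + x) ∈ B
  · exact Or.inr ⟨G, hB⟩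
  left
  push Not at hB
  obtain ⟨H, hH⟩ := hB
  refine ⟨(G ×ˢ H).image fun p => p.1 + p.2, fun F => ?_⟩
  obtain ⟨x, hx⟩ := hG ((H ×ˢ F).image fun p => p.1 + p.2)
  refine ⟨x, fun f hf => ?_⟩
  obtain ⟨u, hu, hnot⟩ := hH (f + x)
  obtain ⟨t, ht, hmem⟩ := hx (u + f)
    (Finset.mem_image.2 ⟨(u, f), Finset.mem_product.2 ⟨hu, hf⟩, rfl⟩)
  refine ⟨t + u, Finset.mem_image.2 ⟨(t, u), Finset.mem_product.2 ⟨ht, hu⟩, rfl⟩, ?_⟩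
  rcases hmem with hA | hB
  · convert hA using 1
    abel
  · refine absurd ?_ (hnot t ht)
    convert hB using 1
    abel

theorem exists_of_biUnion {M ι : Type*} [AddCommGroup M] (s : Finset ι) (A : ι → Set M)
    (h : PiecewiseSyndetic (⋃ i ∈ s, A i)) : ∃ i ∈ s, PiecewiseSyndetic (A i) := by
  classical
  induction s using Finset.induction_on with
  | empty => simpa using h.nonempty
  | insert a s ha ih =>
    rw [Finset.set_biUnion_insert] at h
    rcases h.of_union with h | h
    · exact ⟨a, by simp, h⟩
    · obtain ⟨i, hi, h⟩ := ih h
      exact ⟨i, by simp [hi], h⟩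

/-- Some cell of a finite cover meets a piecewise syndetic set in a piecewise syndetic set. -/
theorem exists_inter {M ι : Type*} [AddCommGroup M] [Finite ι] {A : Set M}
    (h : PiecewiseSyndetic A) (D : ι → Set M) (hD : (⋃ i, D i) = Set.univ) :
    ∃ i, PiecewiseSyndetic (A ∩ D i) := by
  have := Fintype.ofFinite ι
  obtain ⟨i, -, hi⟩ := exists_of_biUnion Finset.univ (fun i => A ∩ D i) (by
    simpa [← Set.inter_iUnion, hD] using h)
  exact ⟨i, hi⟩

theorem preimage_add_right {M : Type*} [AddCommGroup M] {A : Set M}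
    (h : PiecewiseSyndetic A) (a : M) : PiecewiseSyndetic {x | x + a ∈ A} := by
  obtain ⟨G, hG⟩ := h
  refine ⟨G, fun F => ?_⟩
  obtain ⟨x, hx⟩ := hG F
  refine ⟨x - a, fun f hf => ?_⟩
  obtain ⟨t, ht, h⟩ := hx f hf
  refine ⟨t, ht, ?_⟩
  rw [Set.mem_ofPred_eq]
  convert h using 1
  abel

/-- A piecewise syndetic set stays piecewise syndetic when multiplied by an element that generates
an ideal of finite index. -/
theorem image_mul_left {R : Type*} [CommRing R] {A : Set R} (h : PiecewiseSyndetic A) {y : R}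
    (hy : ((Ideal.span {y}).toAddSubgroup).index ≠ 0) :
    PiecewiseSyndetic ((fun a => y * a) '' A) := by
  classical
  obtain ⟨G, hG⟩ := h
  have : ((Ideal.span {y}).toAddSubgroup).FiniteIndex := ⟨hy⟩
  have := Fintype.ofFinite (R ⧸ (Ideal.span {y}).toAddSubgroup)
  let T : Finset R := Finset.univ.image
    (fun q : R ⧸ (Ideal.span {y}).toAddSubgroup => q.out)
  have hT : ∀ f : R, ∃ c ∈ T, ∃ q, f = c + y * q := by
    intro f
    refine ⟨_, Finset.mem_image_of_mem _ (Finset.mem_univ (f : R ⧸ _)), ?_⟩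
    have h1 : -(Quotient.out (f : R ⧸ (Ideal.span {y}).toAddSubgroup)) + f ∈
        (Ideal.span {y}).toAddSubgroup :=
      QuotientAddGroup.eq.1 (QuotientAddGroup.out_eq' _)
    obtain ⟨q, hq⟩ := Ideal.mem_span_singleton'.1 h1
    exact ⟨q, by rw [mul_comm, hq]; abel⟩
  choose c hc q hq using hT
  refine ⟨(G ×ˢ T).image fun p => y * p.1 - p.2, fun F => ?_⟩
  obtain ⟨x, hx⟩ := hG (F.image q)
  refine ⟨y * x, fun f hf => ?_⟩
  obtain ⟨t, ht, hmem⟩ := hx (q f) (Finset.mem_image_of_mem q hf)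
  refine ⟨y * t - c f,
    Finset.mem_image.2 ⟨(t, c f), Finset.mem_product.2 ⟨ht, hc f⟩, rfl⟩, _, hmem, ?_⟩
  linear_combination -hq f

/-- A piecewise syndetic set `A` gives a finite colouring all of whose finite patterns are realised
by translates of `A`. -/
theorem exists_coloring {M : Type*} [AddCommGroup M] {A : Set M} (h : PiecewiseSyndetic A) :
    ∃ (G : Finset M) (χ : M → G), ∀ K : Finset M, ∃ x, ∀ k ∈ K, (χ k : M) + (k + x) ∈ A := by
  classical
  obtain ⟨G, hG⟩ := h
  choose x hx using hG
  choose g hgG hg using hx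
  obtain ⟨χ, hχ⟩ := Finset.rado_selection_subtype (β := fun _ : M => G)
    (fun s a => ⟨g s a a.2, hgG s a a.2⟩)
  refine ⟨G, χ, fun K => ?_⟩
  obtain ⟨t, hKt, ht⟩ := hχ K
  refine ⟨x t, fun k hk => ?_⟩
  rw [ht ⟨k, hk⟩]
  exact hg t k (hKt hk)

end PiecewiseSyndetic

section PolynomialRecurrence

open Polynomial

variable {R : Type*} [CommRing R]

open Classical in
/-- The multiset of degrees of a finite set of polynomials, where polynomials with the same leading
term are counted once. -/
noncomputable def degreeMultiset (F : Finset R[X]) : Multiset ℕ :=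
  (F.image fun f => (f.natDegree, f.leadingCoeff)).val.map Prod.fst

theorem degreeMultiset_union_eq_left [DecidableEq R[X]] {F H : Finset R[X]}
    (h : ∀ p ∈ H, ∃ f ∈ F, p.natDegree = f.natDegree ∧ p.leadingCoeff = f.leadingCoeff) :
    degreeMultiset (F ∪ H) = degreeMultiset F := by
  classical
  unfold degreeMultiset
  congr 2
  ext ⟨e, c⟩
  simp only [Finset.mem_image, Finset.mem_union, Prod.mk.injEq]
  constructor
  · rintro ⟨p, hp | hp, h1, h2⟩
    · exact ⟨p, hp, h1, h2⟩
    · obtain ⟨f, hf, h3, h4⟩ := h p hp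
      exact ⟨f, hf, h3 ▸ h1, h4 ▸ h2⟩
  · rintro ⟨p, hp, h1⟩
    exact ⟨p, Or.inl hp, h1⟩

/-- Subtracting a member of minimal degree from all members of a finite set of polynomials makes its
multiset of degrees smaller. -/
theorem degreeMultiset_image_sub_lt [DecidableEq R[X]] {F : Finset R[X]} {f₁ : R[X]}
    (hf₁ : f₁ ∈ F) (hmin : ∀ f ∈ F, f₁.natDegree ≤ f.natDegree) :
    Multiset.IsDershowitzMannaLT (degreeMultiset ((F.image (· - f₁)).erase 0))
      (degreeMultiset F) := by
  classical
  set d := f₁.natDegree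
  set a := f₁.leadingCoeff with ha
  set K := F.image fun f => (f.natDegree, f.leadingCoeff)
  set L := ((F.image (· - f₁)).erase 0).image fun f => (f.natDegree, f.leadingCoeff)
  let φ : ℕ × R → ℕ × R := fun p => if p.1 = d then (p.1, p.2 + a) else p
  have hφ1 : ∀ p, (φ p).1 = p.1 := by
    intro p
    simp only [φ]
    split_ifs <;> rfl
  have hφinj : Function.Injective φ := by
    rintro ⟨e, c⟩ ⟨e', c'⟩ h
    have h1 : e = e' := by simpa [hφ1] using congrArg Prod.fst h
    subst h1
    have h2 := congrArg Prod.snd h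
    simp only [φ] at h2
    split_ifs at h2 with h3
    · simpa using h2
    · simpa using h2
  set U := L.filter fun p => d ≤ p.1 with hU
  set W := L.filter fun p => ¬ d ≤ p.1 with hW
  have hUK : U.image φ ⊆ K.erase (d, a) := by
    intro q hq
    obtain ⟨⟨e, c⟩, hp, rfl⟩ := Finset.mem_image.1 hq
    obtain ⟨hp, hde⟩ := Finset.mem_filter.1 hp
    obtain ⟨p, hp, hpe⟩ := Finset.mem_image.1 hp
    obtain ⟨hp0, hp⟩ := Finset.mem_erase.1 hp
    obtain ⟨g, hg, rfl⟩ := Finset.mem_image.1 hp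
    simp only [Prod.mk.injEq] at hpe
    obtain ⟨rfl, rfl⟩ := hpe
    simp only at hde
    rcases (hmin g hg).lt_or_eq with hlt | heq
    · have h1 : (g - f₁).natDegree = g.natDegree := natDegree_sub_eq_left_of_natDegree_lt hlt
      have h2 : (g - f₁).leadingCoeff = g.leadingCoeff :=
        leadingCoeff_sub_of_degree_lt (degree_lt_degree hlt)
      have h3 : φ ((g - f₁).natDegree, (g - f₁).leadingCoeff) =
          (g.natDegree, g.leadingCoeff) := by
        simp only [φ]
        rw [if_neg (by omega), h1, h2]
      rw [h3]
      refine Finset.mem_erase.2 ⟨fun h => ?_, Finset.mem_image.2 ⟨g, hg, rfl⟩⟩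
      have := congrArg Prod.fst h
      simp only at this
      omega
    · have h1 : (g - f₁).natDegree = d :=
        le_antisymm ((natDegree_sub_le g f₁).trans (by omega)) hde
      have h2 : (g - f₁).leadingCoeff = g.leadingCoeff - a := by
        rw [leadingCoeff, h1, coeff_sub, ha, leadingCoeff, leadingCoeff, ← heq]
      have h3 : φ ((g - f₁).natDegree, (g - f₁).leadingCoeff) =
          (g.natDegree, g.leadingCoeff) := by
        simp only [φ]
        rw [if_pos h1, h1, h2, ← heq, sub_add_cancel]
      rw [h3]
      refine Finset.mem_erase.2 ⟨fun h => hp0 ?_, Finset.mem_image.2 ⟨g, hg, rfl⟩⟩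
      rw [← leadingCoeff_eq_zero, h2]
      exact sub_eq_zero.2 (congrArg Prod.snd h)
  have hdK : (d, a) ∈ K := Finset.mem_image.2 ⟨f₁, hf₁, rfl⟩
  have hUmap : U.val.map Prod.fst = (U.image φ).val.map Prod.fst := by
    rw [Finset.image_val_of_injOn hφinj.injOn, Multiset.map_map]
    exact Multiset.map_congr rfl fun p _ => (hφ1 p).symm
  obtain ⟨Z, hZ⟩ := Multiset.le_iff_exists_add.1
    (Multiset.map_le_map (f := Prod.fst) (Finset.val_le_iff.2 hUK))
  have hKsplit : K.val.map Prod.fst = U.val.map Prod.fst + (d ::ₘ Z) := by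
    rw [hUmap, Multiset.add_cons, ← hZ, ← Multiset.map_cons Prod.fst (d, a), Finset.erase_val,
      Multiset.cons_erase hdK]
  have hLsplit : L.val.map Prod.fst = U.val.map Prod.fst + W.val.map Prod.fst := by
    rw [← Multiset.map_add, hU, hW, Finset.filter_val, Finset.filter_val,
      Multiset.filter_add_not]
  refine ⟨_, _, _, Multiset.cons_ne_zero, hLsplit, hKsplit, fun e he => ⟨d, by simp, ?_⟩⟩
  obtain ⟨p, hp, rfl⟩ := Multiset.mem_map.1 he
  exact not_le.1 (Finset.mem_filter.1 hp).2

/-- `F` is recurrent if, for every piecewise syndetic `A` and outside of any finite set, there is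
`y` such that the points of `A` whose shifts by all the `f(y)` stay in `A` are
piecewise syndetic. -/
def IsRecurrentFamily (F : Finset R[X]) : Prop :=
  ∀ S : Set R, S.Finite → ∀ A : Set R, PiecewiseSyndetic A →
    ∃ y ∉ S, PiecewiseSyndetic {x | x ∈ A ∧ ∀ f ∈ F, x + f.eval y ∈ A}

/-- It suffices to check recurrence on the cells of finite covers. -/
theorem isRecurrentFamily_of_cover {F : Finset R[X]}
    (h : ∀ S : Set R, S.Finite → ∀ (G : Finset R) (D : G → Set R), (⋃ i, D i) = Set.univ →
      ∃ i, ∃ y ∉ S, PiecewiseSyndetic {x | x ∈ D i ∧ ∀ f ∈ F, x + f.eval y ∈ D i}) :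
    IsRecurrentFamily F := by
  classical
  intro S hS A hA
  obtain ⟨G, χ, hχ⟩ := hA.exists_coloring
  obtain ⟨i, y, hy, P, hP⟩ := h S hS G (fun i => {x | χ x = i})
    (Set.eq_univ_of_forall fun x => Set.mem_iUnion.2 ⟨χ x, rfl⟩)
  refine ⟨y, hy, P.image fun s => s + i, fun H => ?_⟩
  obtain ⟨u, hu⟩ := hP H
  let V : Finset R := (P ×ˢ H).image fun p => p.1 + (p.2 + u)
  obtain ⟨x, hx⟩ := hχ (V ∪ (V ×ˢ F).image fun p => p.1 + p.2.eval y)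
  refine ⟨u + x, fun k hk => ?_⟩
  obtain ⟨t, ht, hti, htf⟩ := hu k hk
  have htV : t + (k + u) ∈ V :=
    Finset.mem_image.2 ⟨(t, k), Finset.mem_product.2 ⟨ht, hk⟩, rfl⟩
  refine ⟨t + i, Finset.mem_image_of_mem _ ht, ?_, fun f hf => ?_⟩
  · have := hx _ (Finset.mem_union_left _ htV)
    rw [show χ _ = i from hti] at this
    convert this using 1
    abel
  · have := hx (t + (k + u) + f.eval y) (Finset.mem_union_right _
      (Finset.mem_image.2 ⟨(_, f), Finset.mem_product.2 ⟨htV, hf⟩, rfl⟩))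
    rw [show χ _ = i from htf f hf] at this
    convert this using 1
    abel

/-- The polynomial `f(X + s) - f(s)`. -/
noncomputable def incrementPoly (s : R) (f : R[X]) : R[X] := taylor s f - C (f.eval s)

theorem eval_incrementPoly (s y : R) (f : R[X]) :
    (incrementPoly s f).eval y = f.eval (y + s) - f.eval s := by
  simp [incrementPoly, taylor_eval]

theorem coeff_zero_incrementPoly (s : R) (f : R[X]) : (incrementPoly s f).coeff 0 = 0 := by
  rw [coeff_zero_eq_eval_zero, eval_incrementPoly]
  simp

theorem natDegree_incrementPoly (s : R) (f : R[X]) :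
    (incrementPoly s f).natDegree = f.natDegree := by
  rw [incrementPoly, natDegree_sub_C, natDegree_taylor]

theorem leadingCoeff_incrementPoly (s : R) {f : R[X]} (hf : 0 < f.natDegree) :
    (incrementPoly s f).leadingCoeff = f.leadingCoeff := by
  rw [leadingCoeff, natDegree_incrementPoly, incrementPoly, coeff_sub, coeff_C_of_ne_zero hf.ne',
    sub_zero, coeff_taylor_natDegree]

theorem natDegree_pos_of_coeff_zero {f : R[X]} (h0 : f.coeff 0 = 0) (hf : f ≠ 0) :
    0 < f.natDegree := by
  rw [Nat.pos_iff_ne_zero]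
  intro h
  rw [eq_C_of_natDegree_eq_zero h, h0, C_0] at hf
  exact hf rfl

/-- Colour focusing: if all families of smaller degree are recurrent, then any finite cover has a
cell that is recurrent along `F`. The set `seen` consists of the cells `k` for which `B` has already
been moved into `D k` by all the `f(s k)`. -/
theorem exists_recurrent_cell {ι : Type*} [Finite ι] {F : Finset R[X]} (hne : F.Nonempty)
    (hF : ∀ f ∈ F, f.coeff 0 = 0) (hF0 : 0 ∉ F)
    (ih : ∀ H : Finset R[X], (degreeMultiset H).IsDershowitzMannaLT (degreeMultiset F) →
      (∀ f ∈ H, f.coeff 0 = 0) → 0 ∉ H → IsRecurrentFamily H)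
    {S : Set R} (hS : S.Finite) (D : ι → Set R) (hD : (⋃ i, D i) = Set.univ)
    (seen : Set ι) (s : ι → R) (B : Set R) (hB : PiecewiseSyndetic B)
    (hs : ∀ k ∈ seen, s k ∉ S ∧ ∀ b ∈ B, ∀ f ∈ F, b + f.eval (s k) ∈ D k) :
    ∃ i, ∃ y ∉ S, PiecewiseSyndetic {x | x ∈ D i ∧ ∀ f ∈ F, x + f.eval y ∈ D i} := by
  classical
  induction hn : (seenᶜ).ncard using Nat.strong_induction_on generalizing seen s B with
  | _ n IH =>
  subst hn
  obtain ⟨j, hj⟩ := hB.exists_inter D hD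
  by_cases hjs : j ∈ seen
  · refine ⟨j, s j, (hs j hjs).1, hj.mono fun x hx => ⟨hx.2, (hs j hjs).2 x hx.1⟩⟩
  obtain ⟨f₁, hf₁, hmin⟩ := F.exists_min_image natDegree hne
  have := Fintype.ofFinite ι
  let H : Finset R[X] := (Finset.univ ×ˢ F).image fun p : ι × R[X] => incrementPoly (s p.1) p.2
  have hHF : ∀ p ∈ H, ∃ f ∈ F, p.natDegree = f.natDegree ∧ p.leadingCoeff = f.leadingCoeff := by
    intro p hp
    obtain ⟨⟨k, f⟩, hkf, rfl⟩ := Finset.mem_image.1 hp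
    have hf := (Finset.mem_product.1 hkf).2
    exact ⟨f, hf, natDegree_incrementPoly _ _, leadingCoeff_incrementPoly _
      (natDegree_pos_of_coeff_zero (hF f hf) fun h => hF0 (h ▸ hf))⟩
  have hFH : ∀ p ∈ F ∪ H, p.coeff 0 = 0 := by
    intro p hp
    rcases Finset.mem_union.1 hp with hp | hp
    · exact hF p hp
    · obtain ⟨⟨k, f⟩, -, rfl⟩ := Finset.mem_image.1 hp
      exact coeff_zero_incrementPoly _ _
  have hlt := degreeMultiset_image_sub_lt (F := F ∪ H) (Finset.mem_union_left _ hf₁) (by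
    intro p hp
    rcases Finset.mem_union.1 hp with hp | hp
    · exact hmin p hp
    · obtain ⟨f, hf, h, -⟩ := hHF p hp
      exact h ▸ hmin f hf)
  rw [degreeMultiset_union_eq_left hHF] at hlt
  obtain ⟨y, hy, hPS⟩ := ih _ hlt (by
    intro p hp
    obtain ⟨q, hq, rfl⟩ := Finset.mem_image.1 (Finset.mem_of_mem_erase hp)
    rw [coeff_sub, hFH q hq, hF f₁ hf₁, sub_zero]) (Finset.notMem_erase _ _)
    (S ∪ ⋃ k, (fun y => y + s k) ⁻¹' S)
    (hS.union (Set.finite_iUnion fun k => hS.preimage (add_left_injective _).injOn)) _ hj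
  simp only [Set.mem_union, Set.mem_iUnion, Set.mem_preimage, not_or, not_exists] at hy
  have hmove : ∀ x ∈ {x | x + f₁.eval y ∈ {x | x ∈ B ∩ D j ∧
      ∀ f ∈ ((F ∪ H).image (· - f₁)).erase 0, x + f.eval y ∈ B ∩ D j}},
      ∀ p ∈ F ∪ H, x + p.eval y ∈ B ∩ D j := by
    rintro x ⟨hx, hx'⟩ p hp
    by_cases hp0 : p - f₁ = 0
    · rwa [sub_eq_zero.1 hp0]
    · have := hx' (p - f₁) (Finset.mem_erase.2 ⟨hp0, Finset.mem_image_of_mem _ hp⟩)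
      rwa [eval_sub, add_assoc, add_sub_cancel] at this
  refine IH _ ?_ (insert j seen) (fun k => if k = j then y else y + s k) _
    (hPS.preimage_add_right (f₁.eval y)) ?_ rfl
  · exact Set.ncard_lt_ncard (compl_lt_compl_iff_lt.2 (Set.ssubset_insert hjs))
  · intro k hk
    by_cases hkj : k = j
    · subst hkj
      simp only [if_true]
      exact ⟨hy.1, fun b hb f hf => (hmove b hb f (Finset.mem_union_left _ hf)).2⟩
    · simp only [if_neg hkj]
      refine ⟨hy.2 k, fun b hb f hf => ?_⟩
      have hb' := hmove b hb (incrementPoly (s k) f) (Finset.mem_union_right _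
        (Finset.mem_image.2 ⟨(k, f), by simp [hf], rfl⟩))
      have := (hs k (Set.mem_of_mem_insert_of_ne hk hkj)).2 _ hb'.1 f hf
      rwa [eval_incrementPoly, add_assoc, sub_add_cancel] at this

/-- The polynomial van der Waerden theorem for piecewise syndetic sets. -/
theorem isRecurrentFamily_of_coeff_zero [Infinite R] (F : Finset R[X])
    (hF : ∀ f ∈ F, f.coeff 0 = 0) : IsRecurrentFamily F := by
  classical
  have key : ∀ (M : Multiset ℕ) (F : Finset R[X]), degreeMultiset F = M →
      (∀ f ∈ F, f.coeff 0 = 0) → 0 ∉ F → IsRecurrentFamily F := by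
    intro M
    induction M using (Multiset.wellFounded_isDershowitzMannaLT (α := ℕ)).induction with
    | _ M ih =>
    rintro F rfl hF hF0
    rcases F.eq_empty_or_nonempty with rfl | hne
    · intro S hS A hA
      obtain ⟨y, hy⟩ := hS.exists_notMem
      exact ⟨y, hy, by simpa using hA⟩
    · exact isRecurrentFamily_of_cover fun S hS G D hD =>
        exists_recurrent_cell hne hF hF0 (fun H hH => ih _ hH H rfl) hS D hD ∅ (fun _ => 0)
          Set.univ PiecewiseSyndetic.univ (by simp)
  intro S hS A hA
  obtain ⟨y, hy, h⟩ := key _ (F.erase 0) rfl (fun f hf => hF f (Finset.mem_of_mem_erase hf))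
    (Finset.notMem_erase _ _) S hS A hA
  refine ⟨y, hy, h.mono fun x hx => ⟨hx.1, fun f hf => ?_⟩⟩
  by_cases hf0 : f = 0
  · simpa [hf0] using hx.1
  · exact hx.2 f (Finset.mem_erase.2 ⟨hf0, hf⟩)

/-- Colour focusing with dilations. The set `seen` consists of the cells `k` for which
all quotients `x` of elements of `B` by `s k`, and all `x + f (s k)`, are known to lie in `D k`. -/
theorem exists_cell_mul_add [IsDomain R] [Infinite R]
    (hLID : ∀ I : Ideal R, I ≠ ⊥ → (I.toAddSubgroup).index ≠ 0)
    {ι : Type*} [Finite ι] {F : Finset R[X]} (hF : ∀ f ∈ F, f.coeff 0 = 0)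
    {S : Set R} (hS : S.Finite) (hS0 : 0 ∈ S) (D : ι → Set R) (hD : (⋃ i, D i) = Set.univ)
    (seen : Set ι) (s : ι → R) (B : Set R) (hB : PiecewiseSyndetic B)
    (hs : ∀ k ∈ seen, s k ∉ S ∧
      ∀ b ∈ B, ∃ x ∈ D k, x * s k = b ∧ ∀ f ∈ F, x + f.eval (s k) ∈ D k) :
    ∃ i, ∃ z ∉ S, ∃ E, PiecewiseSyndetic E ∧
      ∀ w ∈ E, w ∈ D i ∧ ∃ x, x * z = w ∧ ∀ f ∈ F, x + f.eval z ∈ D i := by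
  classical
  induction hn : (seenᶜ).ncard using Nat.strong_induction_on generalizing seen s B with
  | _ n IH =>
  subst hn
  obtain ⟨j, hj⟩ := hB.exists_inter D hD
  by_cases hjs : j ∈ seen
  · refine ⟨j, s j, (hs j hjs).1, _, hj, fun w hw => ⟨hw.2, ?_⟩⟩
    obtain ⟨x, -, hx⟩ := (hs j hjs).2 w hw.1
    exact ⟨x, hx⟩
  have := Fintype.ofFinite ι
  let H : Finset R[X] := (Finset.univ ×ˢ F).image
    fun p : ι × R[X] => C (s p.1) * p.2.comp (C (s p.1) * X)
  have hFH : ∀ p ∈ F ∪ H, p.coeff 0 = 0 := by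
    intro p hp
    rcases Finset.mem_union.1 hp with hp | hp
    · exact hF p hp
    · obtain ⟨⟨k, f⟩, hkf, rfl⟩ := Finset.mem_image.1 hp
      have := hF f (Finset.mem_product.1 hkf).2
      rw [coeff_zero_eq_eval_zero] at this ⊢
      simp [eval_comp, this]
  have hfin : (S ∪ ⋃ k ∈ seen, (fun y => s k * y) ⁻¹' S).Finite := by
    refine hS.union (Set.Finite.biUnion seen.toFinite fun k hk => hS.preimage ?_)
    have hk0 : s k ≠ 0 := fun h => (hs k hk).1 (h ▸ hS0)
    exact (mul_right_injective₀ hk0).injOn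
  obtain ⟨y, hy, hPS⟩ := isRecurrentFamily_of_coeff_zero (F ∪ H) hFH _ hfin _ hj
  simp only [Set.mem_union, Set.mem_iUnion, Set.mem_preimage, not_or, not_exists] at hy
  have hy0 : y ≠ 0 := fun h => hy.1 (h ▸ hS0)
  refine IH _ ?_ (insert j seen) (fun k => if k = j then y else s k * y) _
    (hPS.image_mul_left (hLID (Ideal.span {y}) (by simpa using hy0))) ?_ rfl
  · exact Set.ncard_lt_ncard (compl_lt_compl_iff_lt.2 (Set.ssubset_insert hjs))
  · intro k hk
    by_cases hkj : k = j
    · subst hkj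
      simp only [if_true]
      refine ⟨hy.1, ?_⟩
      rintro _ ⟨b, ⟨hb, hbF⟩, rfl⟩
      exact ⟨b, hb.2, mul_comm _ _, fun f hf => (hbF f (Finset.mem_union_left _ hf)).2⟩
    · simp only [if_neg hkj]
      have hks := Set.mem_of_mem_insert_of_ne hk hkj
      have hk0 : s k ≠ 0 := fun h => (hs k hks).1 (h ▸ hS0)
      refine ⟨hy.2 k hks, ?_⟩
      rintro _ ⟨b, ⟨hb, hbF⟩, rfl⟩
      obtain ⟨x, hxD, hxb, -⟩ := (hs k hks).2 b hb.1
      refine ⟨x, hxD, by rw [← hxb]; ring, fun f hf => ?_⟩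
      have hb' := (hbF _ (Finset.mem_union_right _
        (Finset.mem_image.2 ⟨(k, f), by simp [hf], rfl⟩))).1
      obtain ⟨x', hxD', hxb', -⟩ := (hs k hks).2 _ hb'
      have hxx' : x' = x + f.eval (s k * y) := by
        apply mul_right_cancel₀ hk0
        rw [hxb', ← hxb]
        simp only [eval_mul, eval_C, eval_comp, eval_X]
        ring
      exact hxx' ▸ hxD'

end PolynomialRecurrence

/-- Main theorem: refinement of Moreira's theorem for large ideal domains. For any finite
coloring of a LID `R` there exist a color `i`, an injective sequence `⟨z_n⟩` in `R∖{0,1}`, and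
piecewise syndetic sets `E_n ⊆ R·z_n` such that whenever `w ∈ E_n` and `x·z_n = w`, the set
`{x·z_n} ∪ {x + f(z_n) : f ∈ F}` lies in `C i`. -/
theorem stmt_13 {R : Type*} [CommRing R] [IsDomain R] [Infinite R]
    (hLID : ∀ I : Ideal R, I ≠ ⊥ → (I.toAddSubgroup).index ≠ 0)
    (r : ℕ) (F : Finset (Polynomial R)) (hF : ∀ f ∈ F, f.coeff 0 = 0)
    (C : Fin r → Set R) (hcover : (⋃ i, C i) = Set.univ) :
    ∃ i : Fin r, ∃ z : ℕ → R, ∃ E : ℕ → Set R,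
      Function.Injective z ∧
      (∀ n : ℕ, z n ≠ 0 ∧ z n ≠ 1) ∧
      (∀ n : ℕ, PiecewiseSyndetic (E n)) ∧
      (∀ n : ℕ, E n ⊆ {w : R | ∃ x : R, x * z n = w}) ∧
      (∀ n : ℕ, ∀ w ∈ E n, ∀ x : R, x * z n = w →
        x * z n ∈ C i ∧ ∀ f ∈ F, x + f.eval (z n) ∈ C i) := by
  classical
  let P : Fin r → R → Set R → Prop := fun i z E => PiecewiseSyndetic E ∧
    ∀ w ∈ E, w ∈ C i ∧ ∃ x, x * z = w ∧ ∀ f ∈ F, x + f.eval z ∈ C i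
  have hex : ∃ i, ∀ S : Set R, S.Finite → 0 ∈ S → ∃ z ∉ S, ∃ E, P i z E := by
    by_contra! hcon
    choose S hS hS0 hno using hcon
    obtain ⟨i, z, hz, E, hE⟩ := exists_cell_mul_add hLID hF
      (S := insert 0 (⋃ i, S i)) ((Set.finite_iUnion hS).insert 0) (Set.mem_insert _ _) C hcover
      ∅ (fun _ => 0) Set.univ PiecewiseSyndetic.univ (by simp)
    exact hno i z (fun h => hz (Set.mem_insert_of_mem _ (Set.mem_iUnion.2 ⟨i, h⟩))) E hE
  obtain ⟨i, hi⟩ := hex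
  have hinf : {z : R | (z ≠ 0 ∧ z ≠ 1) ∧ ∃ E, P i z E}.Infinite := by
    intro hfin
    obtain ⟨z, hz, E, hE⟩ := hi _ ((hfin.insert 1).insert 0) (Set.mem_insert _ _)
    simp only [Set.mem_insert_iff, not_or] at hz
    exact hz.2.2 ⟨⟨hz.1, hz.2.1⟩, E, hE⟩
  let e := hinf.natEmbedding
  choose E hE using fun n => (e n).2.2
  refine ⟨i, fun n => e n, E, Subtype.val_injective.comp e.injective, fun n => (e n).2.1,
    fun n => (hE n).1, fun n w hw => ?_, fun n w hw x hx => ?_⟩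
  · obtain ⟨-, x, hx, -⟩ := (hE n).2 w hw
    exact ⟨x, hx⟩
  · obtain ⟨hwC, x', hx', hF'⟩ := (hE n).2 w hw
    have : x' = x := mul_right_cancel₀ (e n).2.1.1 (hx'.trans hx.symm)
    exact ⟨hx ▸ hwC, this ▸ hF'⟩
end
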